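/- Fix an integer k ≥ 3 and set M = M(N) := ⌊N^(1/k)⌋. Then for every ε > 0 there exists N₀ such that for all N ≥ N₀, the number of pairs (x,w) ∈ (ℤ/Nℤ)ᵏ × (ℤ/Nℤ) with 1 ≤ η^x_w ≤ 4 is at least (1 − 3π²/32 − ε) · N^(k+1); in particular this fraction of pairs is lower bounded by the positive constant 0.07 for N sufficiently large. -/

import Mathlib

/-- `η^x_w` is the number of `b ∈ {0,…,M-1}^k` with `b₁x₁ + ⋯ + b_kx_k ≡ w (mod N)`. -/
def eta (N M k : ℕ) (x : Fin k → ZMod N) (w : ZMod N) : ℕ :=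
  (Finset.univ.filter
    (fun b : Fin k → Fin M => ∑ i, ((b i : ℕ) : ZMod N) * x i = w)).card

/-- `Mfl k N = ⌊N^(1/k)⌋`, the integer part of the real `k`-th root of `N`. -/
noncomputable def Mfl (k N : ℕ) : ℕ := Nat.floor ((N : ℝ) ^ ((1 : ℝ) / k))

/-- The number of solutions of a homogeneous linear equation over `ℤ/Nℤ` with integer coefficients
is `N^(k-1)` times a common divisor of the coefficients. -/
lemma exists_dvd_card_linear_solutions (N k : ℕ) [NeZero N] (c : Fin k → ℤ) :
    ∃ d : ℕ, 0 < d ∧ (∀ i, (d : ℤ) ∣ c i) ∧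
      N * (Finset.univ.filter
        (fun x : Fin k → ZMod N => ∑ i, (c i : ZMod N) * x i = 0)).card = N ^ k * d := by
  let f : (Fin k → ZMod N) →+ ZMod N :=
    { toFun := fun x => ∑ i, (c i : ZMod N) * x i
      map_zero' := by simp
      map_add' := fun x y => by simp [mul_add, Finset.sum_add_distrib] }
  have hN : Nat.card f.range * f.range.index = N := by
    rw [AddSubgroup.card_mul_index, Nat.card_zmod]
  have hK : Nat.card f.ker * Nat.card f.range = N ^ k := by
    rw [← AddSubgroup.index_ker, AddSubgroup.card_mul_index]
    simp [Nat.card_eq_fintype_card, ZMod.card]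
  have hker : (Finset.univ.filter
      (fun x : Fin k → ZMod N => ∑ i, (c i : ZMod N) * x i = 0)).card = Nat.card f.ker := by
    rw [Nat.card_eq_fintype_card]
    exact (Fintype.card_of_subtype _ (fun x => by simp [f, AddMonoidHom.mem_ker])).symm
  have hR : Nat.card f.range ≠ 0 := by
    intro h
    rw [h, zero_mul] at hN
    exact NeZero.ne N hN.symm
  refine ⟨f.range.index, Nat.pos_of_ne_zero fun h => ?_, fun i => ?_, ?_⟩
  · rw [h, mul_zero] at hN
    exact NeZero.ne N hN.symm
  · have hmem : (c i : ZMod N) ∈ f.range :=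
      ⟨Pi.single i 1, by simp [f, Pi.single_apply]⟩
    have h0 : Nat.card f.range • (c i : ZMod N) = 0 :=
      congrArg Subtype.val (card_nsmul_eq_zero' (x := (⟨_, hmem⟩ : f.range)))
    have h1 : ((Nat.card f.range * c i : ℤ) : ZMod N) = 0 := by
      rw [← h0]
      simp
    rw [ZMod.intCast_zmod_eq_zero_iff_dvd] at h1
    have h2 : (Nat.card f.range : ℤ) * f.range.index ∣ Nat.card f.range * c i := by
      rw [← Nat.cast_mul, hN]
      exact h1
    exact (mul_dvd_mul_iff_left (by exact_mod_cast hR)).mp h2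
  · rw [hker]
    calc N * Nat.card f.ker = Nat.card f.ker * Nat.card f.range * f.range.index := by
          rw [mul_assoc, hN, mul_comm]
      _ = _ := by rw [hK]

/-- Pairs of elements of `{0, …, M-1}` which are congruent modulo `e`. -/
def congruentPairs (M e : ℕ) : Finset (Fin M × Fin M) :=
  Finset.univ.filter fun p => (p.1 : ℕ) % e = (p.2 : ℕ) % e

lemma card_congruentPairs_le_sq (M e : ℕ) : (congruentPairs M e).card ≤ M ^ 2 :=
  (Finset.card_le_univ _).trans (by simp [sq])

lemma card_filter_fin_mod_eq (M e v : ℕ) (he : 0 < e) (hv : v < e) :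
    (Finset.univ.filter fun a : Fin M => (a : ℕ) % e = v).card =
      M / e + if v < M % e then 1 else 0 := by
  have h := Nat.count_modEq_card M he v
  rw [Nat.mod_eq_of_lt hv] at h
  rw [← h, Nat.count_eq_card_filter_range, ← Nat.Iio_eq_range,
    ← Fin.map_valEmbedding_univ, Finset.filter_map, Finset.card_map]
  refine congrArg Finset.card (Finset.filter_congr fun a _ => ?_)
  simp [Nat.ModEq, Nat.mod_eq_of_lt hv]

lemma card_congruentPairs_eq (M e : ℕ) (he : 0 < e) :
    (congruentPairs M e).card = ∑ v ∈ Finset.range e, (M / e + if v < M % e then 1 else 0) ^ 2 := by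
  rw [Finset.card_eq_sum_card_fiberwise (f := fun p => (p.1 : ℕ) % e) (t := Finset.range e)
    (fun p _ => by simpa using Nat.mod_lt _ he)]
  refine Finset.sum_congr rfl fun v hv => ?_
  rw [← card_filter_fin_mod_eq M e v he (Finset.mem_range.mp hv), sq, ← Finset.card_product]
  congr 1
  ext p
  simp only [congruentPairs, Finset.mem_filter, Finset.mem_univ, true_and, Finset.mem_product]
  constructor
  · rintro ⟨h, h'⟩
    exact ⟨h', h ▸ h'⟩
  · rintro ⟨h, h'⟩
    exact ⟨h.trans h'.symm, h⟩

lemma four_mul_card_congruentPairs_le (M e : ℕ) (he : 0 < e) :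
    4 * e * (congruentPairs M e).card ≤ 4 * M ^ 2 + e ^ 2 := by
  have hr : M % e < e := Nat.mod_lt _ he
  have hM := Nat.div_add_mod M e
  have hsum : (congruentPairs M e).card = e * (M / e) ^ 2 + (2 * (M / e) + 1) * (M % e) := by
    rw [card_congruentPairs_eq M e he]
    have h1 : ∀ v ∈ Finset.range e, (M / e + if v < M % e then 1 else 0) ^ 2 =
        (M / e) ^ 2 + if v < M % e then 2 * (M / e) + 1 else 0 := by
      intro v _
      split_ifs <;> ring
    have h2 : (Finset.range e).filter (fun v => v < M % e) = Finset.range (M % e) := by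
      ext v
      simp only [Finset.mem_filter, Finset.mem_range]
      omega
    rw [Finset.sum_congr rfl h1, Finset.sum_add_distrib, ← Finset.sum_filter, h2]
    simp
    ring
  rw [hsum]
  generalize M / e = q at *
  generalize M % e = r at *
  subst hM
  zify
  nlinarith [sq_nonneg ((e : ℤ) - 2 * r)]

lemma card_filter_forall_mod_eq (M k e : ℕ) :
    (Finset.univ.filter fun p : (Fin k → Fin M) × (Fin k → Fin M) =>
      ∀ i, (p.1 i : ℕ) % e = (p.2 i : ℕ) % e).card = (congruentPairs M e).card ^ k := by
  rw [← Fintype.card_piFinset_const (congruentPairs M e) k]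
  refine Finset.card_equiv (Equiv.arrowProdEquivProdArrow _ _ _).symm fun p => ?_
  simp [congruentPairs, Fintype.mem_piFinset]

lemma sum_weighted_inv_sq_le (n : ℕ) (hn : 1 ≤ n) :
    ∑ e ∈ Finset.Icc 1 n, (if e = 1 then (1 : ℝ) else 125 / 64 / (e : ℝ) ^ 2) ≤
      1 + 125 / 64 * (2 / 3) - 125 / 64 / (n + 1 / 2) := by
  induction n, hn using Nat.le_induction with
  | base => norm_num
  | succ n hn ih =>
    rw [Finset.sum_Icc_succ_top (by omega), if_neg (by omega)]
    have h : (1 : ℝ) / ((n : ℝ) + 1) ^ 2 ≤ 1 / (n + 1 / 2) - 1 / (n + 1 + 1 / 2) := by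
      rw [div_sub_div _ _ (by positivity) (by positivity), div_le_div_iff₀ (by positivity)
        (by positivity)]
      nlinarith
    have h' := mul_le_mul_of_nonneg_left h (by norm_num : (0 : ℝ) ≤ 125 / 64)
    simp only [mul_sub, mul_one_div] at h'
    push_cast
    linarith

lemma sum_mul_card_congruentPairs_pow_le (M k : ℕ) (hk : 3 ≤ k) :
    ∑ e ∈ Finset.Icc 1 M, (e : ℝ) * ((congruentPairs M e).card : ℝ) ^ k ≤
      (1 + 125 / 64 * (2 / 3)) * ((M : ℝ) ^ k) ^ 2 := by
  rcases Nat.eq_zero_or_pos M with rfl | hM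
  · simp
    positivity
  have hterm : ∀ e ∈ Finset.Icc 1 M, (e : ℝ) * ((congruentPairs M e).card : ℝ) ^ k ≤
      (if e = 1 then (1 : ℝ) else 125 / 64 / (e : ℝ) ^ 2) * ((M : ℝ) ^ k) ^ 2 := by
    intro e he
    obtain ⟨he1, heM⟩ := Finset.mem_Icc.mp he
    have hA : ((congruentPairs M e).card : ℝ) ≤ (M : ℝ) ^ 2 := by
      exact_mod_cast card_congruentPairs_le_sq M e
    have hpow : ((M : ℝ) ^ k) ^ 2 = ((M : ℝ) ^ 2) ^ k := by rw [← pow_mul, ← pow_mul, mul_comm]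
    rw [hpow]
    split_ifs with h
    · subst h
      simpa using pow_le_pow_left₀ (by positivity) hA k
    · have he0 : (0 : ℝ) < e := by exact_mod_cast he1
      have heM' : (e : ℝ) ≤ M := by exact_mod_cast heM
      have h4 : 4 * (e : ℝ) * (congruentPairs M e).card ≤ 4 * (M : ℝ) ^ 2 + (e : ℝ) ^ 2 := by
        exact_mod_cast four_mul_card_congruentPairs_le M e he1
      have hB : ((congruentPairs M e).card : ℝ) ≤ 5 / (4 * e) * (M : ℝ) ^ 2 := by
        rw [div_mul_eq_mul_div, le_div_iff₀ (by positivity)]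
        nlinarith
      obtain ⟨j, rfl⟩ := Nat.exists_eq_add_of_le hk
      rw [pow_add, pow_add]
      calc (e : ℝ) * (((congruentPairs M e).card : ℝ) ^ 3 * ((congruentPairs M e).card : ℝ) ^ j)
          ≤ e * ((5 / (4 * e) * (M : ℝ) ^ 2) ^ 3 * ((M : ℝ) ^ 2) ^ j) := by gcongr
        _ = _ := by
          field_simp
          ring
  refine (Finset.sum_le_sum hterm).trans ?_
  rw [← Finset.sum_mul]
  refine mul_le_mul_of_nonneg_right ((sum_weighted_inv_sq_le M hM).trans ?_) (by positivity)
  have : (0 : ℝ) ≤ 125 / 64 / ((M : ℝ) + 1 / 2) := by positivity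
  linarith

lemma sum_card_fiber {α β : Type*} [Fintype α] [Fintype β] [DecidableEq β] (f : α → β) :
    ∑ w, (Finset.univ.filter fun a => f a = w).card = Fintype.card α := by
  rw [← Finset.card_univ]
  exact (Finset.card_eq_sum_card_fiberwise
    fun _ _ => Finset.mem_coe.mpr (Finset.mem_univ _)).symm

lemma sum_card_fiber_sq {α β : Type*} [Fintype α] [Fintype β] [DecidableEq β] (f : α → β) :
    ∑ w, (Finset.univ.filter fun a => f a = w).card ^ 2 =
      ∑ p : α × α, if f p.1 = f p.2 then 1 else 0 := by
  simp only [sq, Finset.card_filter, Finset.sum_mul_sum, Fintype.sum_prod_type]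
  rw [Finset.sum_comm]
  refine Finset.sum_congr rfl fun a _ => ?_
  rw [Finset.sum_comm]
  refine Finset.sum_congr rfl fun a' _ => ?_
  simp [eq_comm]

lemma sum_eta (N M k : ℕ) [NeZero N] :
    ∑ p : (Fin k → ZMod N) × ZMod N, eta N M k p.1 p.2 = N ^ k * M ^ k := by
  simp only [Fintype.sum_prod_type, eta]
  simp only [sum_card_fiber]
  simp [ZMod.card]

lemma mul_card_collisions_le (N M k : ℕ) [NeZero N] (b b' : Fin k → Fin M) :
    N * (Finset.univ.filter fun x : Fin k → ZMod N =>
      ∑ i, ((b i : ℕ) : ZMod N) * x i = ∑ i, ((b' i : ℕ) : ZMod N) * x i).card ≤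
    (if b = b' then N ^ (k + 1) else 0) +
      N ^ k * ∑ e ∈ Finset.Icc 1 M, if ∀ i, (b i : ℕ) % e = (b' i : ℕ) % e then e else 0 := by
  split_ifs with h
  · subst h
    simp [ZMod.card, pow_succ, mul_comm]
  obtain ⟨d, hd, hdvd, hcard⟩ :=
    exists_dvd_card_linear_solutions N k (fun i => ((b i : ℕ) : ℤ) - ((b' i : ℕ) : ℤ))
  have hmod : ∀ i, (b i : ℕ) % d = (b' i : ℕ) % d := fun i =>
    ((Nat.modEq_iff_dvd.mpr (hdvd i)) : (b' i : ℕ) ≡ b i [MOD d]).symm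
  have hdM : d ≤ M := by
    by_contra! hlt
    refine h (funext fun i => Fin.ext ?_)
    have := hmod i
    rwa [Nat.mod_eq_of_lt ((b i).2.trans hlt), Nat.mod_eq_of_lt ((b' i).2.trans hlt)] at this
  have hset : (Finset.univ.filter fun x : Fin k → ZMod N =>
      ∑ i, ((b i : ℕ) : ZMod N) * x i = ∑ i, ((b' i : ℕ) : ZMod N) * x i) =
      Finset.univ.filter fun x : Fin k → ZMod N =>
        ∑ i, ((((b i : ℕ) : ℤ) - ((b' i : ℕ) : ℤ) : ℤ) : ZMod N) * x i = 0 := by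
    refine Finset.filter_congr fun x _ => ?_
    simp only [Int.cast_sub, Int.cast_natCast, sub_mul, Finset.sum_sub_distrib, sub_eq_zero]
  rw [hset, hcard, zero_add]
  refine Nat.mul_le_mul_left _ ?_
  have := Finset.single_le_sum
    (f := fun e => if ∀ i, (b i : ℕ) % e = (b' i : ℕ) % e then e else 0)
    (fun _ _ => Nat.zero_le _) (Finset.mem_Icc.mpr ⟨hd, hdM⟩)
  simpa [hmod] using this

lemma mul_sum_eta_sq_le (N M k : ℕ) [NeZero N] :
    N * ∑ p : (Fin k → ZMod N) × ZMod N, eta N M k p.1 p.2 ^ 2 ≤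
      N ^ (k + 1) * M ^ k + N ^ k * ∑ e ∈ Finset.Icc 1 M, e * (congruentPairs M e).card ^ k := by
  have h1 : ∑ p : (Fin k → ZMod N) × ZMod N, eta N M k p.1 p.2 ^ 2 =
      ∑ q : (Fin k → Fin M) × (Fin k → Fin M), (Finset.univ.filter fun x : Fin k → ZMod N =>
        ∑ i, ((q.1 i : ℕ) : ZMod N) * x i = ∑ i, ((q.2 i : ℕ) : ZMod N) * x i).card := by
    rw [Fintype.sum_prod_type]
    simp only [eta, sum_card_fiber_sq]
    rw [Finset.sum_comm]
    simp only [Finset.card_filter]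
  rw [h1, Finset.mul_sum]
  refine (Finset.sum_le_sum fun q _ => mul_card_collisions_le N M k q.1 q.2).trans ?_
  rw [Finset.sum_add_distrib, ← Finset.mul_sum, Finset.sum_comm]
  refine Nat.add_le_add (le_of_eq ?_) (Nat.mul_le_mul_left _ (Finset.sum_le_sum fun e _ => ?_))
  · rw [Fintype.sum_prod_type]
    simp [mul_comm]
  · rw [← card_filter_forall_mod_eq, ← Finset.sum_filter, Finset.sum_const, smul_eq_mul, mul_comm]

lemma half_le_Mfl_pow (k N : ℕ) (hk : 0 < k) (hN : (2 * k) ^ k ≤ N) :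
    (N : ℝ) / 2 ≤ (Mfl k N : ℝ) ^ k := by
  have hk' : (0 : ℝ) < k := by exact_mod_cast hk
  set y : ℝ := (N : ℝ) ^ ((1 : ℝ) / k) with hy
  have hyk : y ^ k = N := by
    rw [hy, one_div, Real.rpow_inv_natCast_pow (by positivity) hk.ne']
  have hyge : 2 * (k : ℝ) ≤ y := by
    refine le_of_pow_le_pow_left₀ hk.ne' (by positivity) ?_
    rw [hyk]
    exact_mod_cast hN
  have hk1 : (1 : ℝ) ≤ k := by exact_mod_cast hk
  have hy0 : 0 < y := by linarith
  have hM : y - 1 ≤ (Mfl k N : ℝ) := by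
    have := Nat.lt_floor_add_one y
    simp only [Mfl]
    linarith
  have hdiv : (k : ℝ) / y ≤ 1 / 2 := by
    rw [div_le_div_iff₀ hy0 (by norm_num)]
    linarith
  have hinv : 1 / y ≤ 1 := by
    rw [div_le_one hy0]
    linarith
  have hb := one_add_mul_le_pow (a := -(1 / y)) (by linarith) k
  calc (N : ℝ) / 2 = y ^ k * (1 / 2) := by rw [hyk]; ring
    _ ≤ y ^ k * (1 + -(1 / y)) ^ k := by
      refine mul_le_mul_of_nonneg_left (le_trans ?_ hb) (by positivity)
      have : (k : ℝ) * -(1 / y) = -(k / y) := by ring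
      linarith
    _ = (y - 1) ^ k := by
      rw [← mul_pow]
      congr 1
      field_simp
      ring
    _ ≤ _ := pow_le_pow_left₀ (by linarith) hM k

lemma Mfl_pow_le (k N : ℕ) (hk : 0 < k) : (Mfl k N : ℝ) ^ k ≤ N := by
  calc (Mfl k N : ℝ) ^ k ≤ ((N : ℝ) ^ ((1 : ℝ) / k)) ^ k :=
        pow_le_pow_left₀ (by positivity) (Nat.floor_le (by positivity)) k
    _ = N := by rw [one_div, Real.rpow_inv_natCast_pow (by positivity) hk.ne']

lemma five_mul_sub_sq_le_indicator (n : ℕ) :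
    5 * (n : ℝ) - (n : ℝ) ^ 2 ≤ 6 * if 1 ≤ n ∧ n ≤ 4 then 1 else 0 := by
  split_ifs with h
  · obtain ⟨h1, h4⟩ := h
    interval_cases n <;> norm_num
  · rcases Nat.eq_zero_or_pos n with rfl | hn
    · simp
    · have : (5 : ℝ) ≤ n := by exact_mod_cast (by omega : 5 ≤ n)
      nlinarith

lemma eta_good_count_lower_bound (k : ℕ) (hk : 3 ≤ k) (N : ℕ) [NeZero N] (hN : (2 * k) ^ k ≤ N) :
    (0.08 : ℝ) * (N : ℝ) ^ (k + 1) ≤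
      (((Finset.univ : Finset ((Fin k → ZMod N) × ZMod N)).filter
        (fun p => 1 ≤ eta N (Mfl k N) k p.1 p.2 ∧
          eta N (Mfl k N) k p.1 p.2 ≤ 4)).card : ℝ) := by
  have hlow := half_le_Mfl_pow k N (by omega) hN
  have hupp := Mfl_pow_le k N (by omega)
  generalize Mfl k N = M at *
  have hsum : ∑ p : (Fin k → ZMod N) × ZMod N, (eta N M k p.1 p.2 : ℝ) =
      (N : ℝ) ^ k * (M : ℝ) ^ k := by
    exact_mod_cast sum_eta N M k
  have hsq : (N : ℝ) * ∑ p : (Fin k → ZMod N) × ZMod N, (eta N M k p.1 p.2 : ℝ) ^ 2 ≤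
      (N : ℝ) ^ (k + 1) * (M : ℝ) ^ k +
        (N : ℝ) ^ k * ∑ e ∈ Finset.Icc 1 M, (e : ℝ) * ((congruentPairs M e).card : ℝ) ^ k := by
    exact_mod_cast mul_sum_eta_sq_le N M k
  have hcp := sum_mul_card_congruentPairs_pow_le M k hk
  have hind := Finset.sum_le_sum (s := Finset.univ)
    fun (p : (Fin k → ZMod N) × ZMod N) _ => five_mul_sub_sq_le_indicator (eta N M k p.1 p.2)
  rw [Finset.sum_sub_distrib, ← Finset.mul_sum, ← Finset.mul_sum, hsum, Finset.sum_boole] at hind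
  have hN0 : (0 : ℝ) < N := by exact_mod_cast Nat.pos_of_ne_zero (NeZero.ne N)
  have hNk : (0 : ℝ) < (N : ℝ) ^ k := by positivity
  set S := ∑ p : (Fin k → ZMod N) × ZMod N, (eta N M k p.1 p.2 : ℝ) ^ 2
  set m : ℝ := (M : ℝ) ^ k
  have hm2 : m ^ 2 ≤ N * m := by nlinarith
  have hS : (N : ℝ) * S ≤ N * ((N : ℝ) ^ k * (3.303 * m)) := by
    have h1 := mul_le_mul_of_nonneg_left (hcp.trans
      (mul_le_mul_of_nonneg_left hm2 (by norm_num))) hNk.le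
    have h2 : 0 ≤ (N : ℝ) ^ k * (N * m) := by
      have : 0 ≤ m := by linarith
      positivity
    rw [pow_succ] at hsq
    nlinarith
  have hS' := le_of_mul_le_mul_left hS hN0
  have hfin := mul_le_mul_of_nonneg_left hlow hNk.le
  rw [pow_succ]
  linarith

/-- For fixed `k ≥ 3` and `M = ⌊N^(1/k)⌋`, the number of pairs `(x, w)` with
`1 ≤ η^x_w ≤ 4` is at least `(1 - 3π²/32 - ε) N^(k+1)` for all sufficiently large `N`;
in particular it is at least `0.07 · N^(k+1)` for all sufficiently large `N`. -/
theorem eta_many_good_instances (k : ℕ) (hk : 3 ≤ k) :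
    (∀ ε : ℝ, 0 < ε → ∃ N₀ : ℕ, ∀ (N : ℕ) [NeZero N], N₀ ≤ N →
      (1 - 3 * Real.pi ^ 2 / 32 - ε) * (N : ℝ) ^ (k + 1) ≤
        (((Finset.univ : Finset ((Fin k → ZMod N) × ZMod N)).filter
          (fun p => 1 ≤ eta N (Mfl k N) k p.1 p.2 ∧
            eta N (Mfl k N) k p.1 p.2 ≤ 4)).card : ℝ)) ∧
    (∃ N₀ : ℕ, ∀ (N : ℕ) [NeZero N], N₀ ≤ N →
      (0.07 : ℝ) * (N : ℝ) ^ (k + 1) ≤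
        (((Finset.univ : Finset ((Fin k → ZMod N) × ZMod N)).filter
          (fun p => 1 ≤ eta N (Mfl k N) k p.1 p.2 ∧
            eta N (Mfl k N) k p.1 p.2 ≤ 4)).card : ℝ)) := by
  have hpi : 1 - 3 * Real.pi ^ 2 / 32 ≤ (0.08 : ℝ) := by nlinarith [Real.pi_gt_d2]
  refine ⟨fun ε hε => ⟨(2 * k) ^ k, fun N _ hN => ?_⟩, ⟨(2 * k) ^ k, fun N _ hN => ?_⟩⟩
  · exact (mul_le_mul_of_nonneg_right (by linarith) (by positivity)).trans
      (eta_good_count_lower_bound k hk N hN)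
  · exact (mul_le_mul_of_nonneg_right (by norm_num) (by positivity)).trans
      (eta_good_count_lower_bound k hk N hN)
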